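/- arXiv:2307.08458 — 2 statements merged into one kernel-verified Lean document; each statement's English description precedes it below -/
import Mathlib

section
/- The function σ : (0,∞) → ℝ defined by σ(x) = 12x · ln( Γ(x+1) / (√(2πx) · (x/e)^x) ) is strictly increasing on (0,∞); that is, for all real numbers 0 < x₁ < x₂ one has σ(x₁) < σ(x₂). -/
open Real

/-- The Stirling remainder `σ(x) = 12x · ln( Γ(x+1) / (√(2πx)·(x/e)^x) )`. -/
noncomputable def stirlingSigma (x : ℝ) : ℝ :=
  12 * x * Real.log (Real.Gamma (x + 1) / (Real.sqrt (2 * π * x) * (x / Real.exp 1) ^ x))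

open Filter Topology

/-- log form of the Stirling remainder -/
noncomputable def stTheta (x : ℝ) : ℝ :=
  Real.log (Real.Gamma (x + 1)) - (x + 1 / 2) * Real.log x + x - Real.log (2 * π) / 2

/-- the difference of `stTheta` -/
noncomputable def stG (x : ℝ) : ℝ :=
  (x + 1 / 2) * (Real.log (x + 1) - Real.log x) - 1

/-- the second difference of `x * stTheta x` at `u - 1` -/
noncomputable def stK (u : ℝ) : ℝ :=
  (2 * u ^ 2 + 1) * Real.log u - (u - 1) * (u - 1 / 2) * Real.log (u - 1)
    - (u + 1) * (u + 1 / 2) * Real.log (u + 1) + 2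

/-- derivative of `stK` -/
noncomputable def stK1 (u : ℝ) : ℝ :=
  4 * u * Real.log u + 1 / u - (2 * u - 3 / 2) * Real.log (u - 1)
    - (2 * u + 3 / 2) * Real.log (u + 1)

theorem stirlingSigma_eq {x : ℝ} (hx : 0 < x) : stirlingSigma x = 12 * (x * stTheta x) := by
  have hG : 0 < Real.Gamma (x + 1) := Real.Gamma_pos_of_pos (by linarith)
  have h2 : 0 < 2 * π := by positivity
  unfold stirlingSigma stTheta
  rw [Real.log_div hG.ne' (by positivity), Real.log_mul (by positivity) (by positivity),
    Real.log_sqrt (by positivity), Real.log_rpow (by positivity),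
    Real.log_div hx.ne' (by positivity), Real.log_exp, Real.log_mul h2.ne' hx.ne']
  ring

theorem stTheta_sub {x : ℝ} (hx : 0 < x) : stTheta x - stTheta (x + 1) = stG x := by
  have hG : 0 < Real.Gamma (x + 1) := Real.Gamma_pos_of_pos (by linarith)
  have hx1 : 0 < x + 1 := by linarith
  unfold stTheta stG
  rw [Real.Gamma_add_one hx1.ne', Real.log_mul hx1.ne' hG.ne']
  ring

theorem stTheta_second {x : ℝ} (hx : 0 < x) :
    x * stTheta x - 2 * ((x + 1) * stTheta (x + 1)) + (x + 2) * stTheta (x + 2)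
      = stK (x + 1) := by
  have h1 := stTheta_sub hx
  have h2 := stTheta_sub (show 0 < x + 1 by linarith)
  have e : x + 1 + 1 = x + 2 := by ring
  rw [e] at h2
  have h3 : stTheta x = stG x + stG (x + 1) + stTheta (x + 2) := by linarith
  have h4 : stTheta (x + 1) = stG (x + 1) + stTheta (x + 2) := by linarith
  rw [h3, h4]
  unfold stG stK
  rw [add_sub_cancel_right, e]
  ring

theorem stG_hasSum {x : ℝ} (hx : 0 < x) :
    HasSum (fun k : ℕ => (1 / (2 * (k : ℝ) + 3)) * ((1 / (2 * x + 1)) ^ 2) ^ (k + 1)) (stG x) := by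
  have h := (Real.hasSum_log_one_add_inv hx).mul_left (x + 1 / 2)
  have e : Real.log (1 + x⁻¹) = Real.log (x + 1) - Real.log x := by
    rw [← Real.log_div (by positivity) (by positivity)]
    congr 1
    field_simp
  rw [e] at h
  rw [← hasSum_nat_add_iff' 1] at h
  have key : ∀ (f g : ℕ → ℝ) (a b : ℝ), f = g → a = b → HasSum g b → HasSum f a := by
    rintro f g a b rfl rfl h
    exact h
  refine key _ _ _ _ ?_ ?_ h
  · funext k
    push_cast
    have : (1 / (2 * x + 1)) ^ (2 * (k + 1) + 1)
      = ((1 / (2 * x + 1)) ^ 2) ^ (k + 1) * (1 / (2 * x + 1)) := by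
      rw [← pow_mul, ← pow_succ]
    rw [this]
    field_simp
    ring
  · unfold stG
    simp
    field_simp

theorem stG_lower {x : ℝ} (hx : 0 < x) :
    1 / (12 * (x + 1 / 2)) - 1 / (12 * (x + 1 + 1 / 2)) ≤ stG x := by
  have h := (stG_hasSum hx).tsum_eq
  have h1 := (stG_hasSum hx).summable.le_tsum 0 (fun k _ => by positivity)
  rw [h] at h1
  refine le_trans ?_ h1
  simp only [Nat.cast_zero, zero_add, pow_one]
  rw [div_sub_div _ _ (by positivity) (by positivity), div_pow, ← mul_div_mul_comm,
    div_le_div_iff₀ (by positivity) (by positivity)]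
  nlinarith [pow_pos hx 2, pow_pos hx 3]

theorem stG_upper {x : ℝ} (hx : 0 < x) :
    stG x ≤ 1 / (12 * x) - 1 / (12 * (x + 1)) := by
  have hr1 : (1 / (2 * x + 1)) ^ 2 < 1 := by
    rw [div_pow, div_lt_one (by positivity)]
    nlinarith
  have hg := (hasSum_geometric_of_lt_one (by positivity) hr1).mul_left
    ((1 / 3) * (1 / (2 * x + 1)) ^ 2)
  have := hasSum_le (fun k => ?_) (stG_hasSum hx) hg
  · refine this.trans (le_of_eq ?_)
    have : 1 - (1 / (2 * x + 1)) ^ 2 = 4 * x * (x + 1) / (2 * x + 1) ^ 2 := by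
      field_simp
      ring
    rw [this]
    field_simp
    ring
  · rw [pow_succ']
    rw [← mul_assoc]
    gcongr
    have : (0 : ℝ) ≤ k := Nat.cast_nonneg k
    linarith

theorem stTheta_tendsto {x : ℝ} (hx : 0 < x) :
    Tendsto (fun n : ℕ => stTheta (x + n)) atTop (𝓝 0) := by
  have h1 := Real.BohrMollerup.tendsto_log_gamma hx
  have h2 : Tendsto (fun n => Real.log (Stirling.stirlingSeq n)) atTop (𝓝 (Real.log (√π))) :=
    (Real.continuousAt_log (by positivity)).tendsto.comp Stirling.tendsto_stirlingSeq_sqrt_pi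
  have h3 : Tendsto (fun n : ℕ => (n : ℝ) * Real.log (1 + x / n)) atTop (𝓝 x) :=
    (Real.tendsto_mul_log_one_add_div_atTop x).comp tendsto_natCast_atTop_atTop
  have h4 : Tendsto (fun n : ℕ => Real.log (1 + x / n)) atTop (𝓝 0) := by
    have := (tendsto_const_div_atTop_nhds_zero_nat x).const_add 1
    have h := (Real.continuousAt_log (x := 1 + 0) (by norm_num)).tendsto.comp this
    rw [add_zero, Real.log_one] at h
    exact h
  have h5 := ((h1.const_sub (Real.log (Real.Gamma x))).add
    (h2.sub_const (Real.log (√π)))).add ((h3.const_sub x).sub (h4.const_mul (x + 1 / 2)))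
  simp only [sub_self, mul_zero, add_zero] at h5
  refine h5.congr' ?_
  filter_upwards [eventually_gt_atTop 0] with n hn
  have hn' : (0 : ℝ) < n := by exact_mod_cast hn
  have hf := Real.BohrMollerup.f_add_nat_eq (f := fun y => Real.log (Real.Gamma y))
    (fun {y} hy => by
      rw [Real.Gamma_add_one hy.ne', Real.log_mul hy.ne' (Real.Gamma_pos_of_pos hy).ne',
        add_comm]) hx (n + 1)
  have e : x + n + 1 = x + ((n + 1 : ℕ) : ℝ) := by push_cast; ring
  have e2 : Real.log (1 + x / n) = Real.log (x + n) - Real.log n := by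
    rw [← Real.log_div (by positivity) (by positivity)]
    congr 1
    field_simp
    ring
  unfold stTheta
  rw [e, hf, Stirling.log_stirlingSeq_formula, e2, Real.BohrMollerup.logGammaSeq,
    Real.log_sqrt pi_pos.le, Real.log_mul (by norm_num) hn'.ne',
    Real.log_mul (by norm_num) pi_pos.ne', Real.log_div hn'.ne' (by positivity), Real.log_exp]
  ring

theorem stTheta_upper {x : ℝ} (hx : 0 < x) : stTheta x ≤ 1 / (12 * x) := by
  have hm : Monotone (fun n : ℕ => stTheta (x + n) - 1 / 12 * (x + n)⁻¹) := by
    refine monotone_nat_of_le_succ fun n => ?_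
    have hp : 0 < x + n := by positivity
    have h1 := stTheta_sub hp
    have h2 := stG_upper hp
    push_cast
    rw [← add_assoc]
    rw [one_div_mul_eq_div, one_div_mul_eq_div]
    have e1 : 1 / (12 * (x + n)) = (x + n)⁻¹ / 12 := by field_simp
    have e2 : 1 / (12 * (x + n + 1)) = (x + n + 1)⁻¹ / 12 := by field_simp
    linarith
  have ht : Tendsto (fun n : ℕ => stTheta (x + n) - 1 / 12 * (x + n)⁻¹) atTop (𝓝 0) := by
    have h : Tendsto (fun n : ℕ => (x + (n : ℝ))⁻¹) atTop (𝓝 0) :=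
      tendsto_inv_atTop_zero.comp
        (tendsto_atTop_add_const_left _ _ tendsto_natCast_atTop_atTop)
    have h' := (stTheta_tendsto hx).sub (h.const_mul (1 / 12))
    rwa [mul_zero, sub_zero] at h'
  have := hm.ge_of_tendsto ht 0
  simp only [Nat.cast_zero, add_zero] at this
  have e1 : 1 / (12 * x) = 1 / 12 * x⁻¹ := by field_simp
  linarith

theorem stTheta_lower {x : ℝ} (hx : 0 < x) : 1 / (12 * (x + 1 / 2)) ≤ stTheta x := by
  have hm : Antitone (fun n : ℕ => stTheta (x + n) - 1 / 12 * (x + n + 1 / 2)⁻¹) := by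
    refine antitone_nat_of_succ_le fun n => ?_
    have hp : 0 < x + n := by positivity
    have h1 := stTheta_sub hp
    have h2 := stG_lower hp
    push_cast
    rw [← add_assoc]
    rw [one_div_mul_eq_div, one_div_mul_eq_div]
    have e1 : 1 / (12 * (x + n + 1 / 2)) = (x + n + 1 / 2)⁻¹ / 12 := by field_simp
    have e2 : 1 / (12 * (x + n + 1 + 1 / 2)) = (x + n + 1 + 1 / 2)⁻¹ / 12 := by field_simp
    linarith
  have ht : Tendsto (fun n : ℕ => stTheta (x + n) - 1 / 12 * (x + n + 1 / 2)⁻¹) atTop (𝓝 0) := by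
    have h : Tendsto (fun n : ℕ => (x + (n : ℝ) + 1 / 2)⁻¹) atTop (𝓝 0) :=
      tendsto_inv_atTop_zero.comp (tendsto_atTop_add_const_right _ _
        (tendsto_atTop_add_const_left _ _ tendsto_natCast_atTop_atTop))
    have h' := (stTheta_tendsto hx).sub (h.const_mul (1 / 12))
    rwa [mul_zero, sub_zero] at h'
  have := hm.le_of_tendsto ht 0
  simp only [Nat.cast_zero, add_zero] at this
  have e1 : 1 / (12 * (x + 1 / 2)) = 1 / 12 * (x + 1 / 2)⁻¹ := by field_simp
  linarith

theorem stH_tendsto {x : ℝ} (hx : 0 < x) :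
    Tendsto (fun n : ℕ => (x + n) * stTheta (x + n)) atTop (𝓝 (1 / 12)) := by
  have h : Tendsto (fun n : ℕ => 1 / 12 - 1 / 24 * (x + (n : ℝ) + 1 / 2)⁻¹) atTop
      (𝓝 (1 / 12)) := by
    have h : Tendsto (fun n : ℕ => (x + (n : ℝ) + 1 / 2)⁻¹) atTop (𝓝 0) :=
      tendsto_inv_atTop_zero.comp (tendsto_atTop_add_const_right _ _
        (tendsto_atTop_add_const_left _ _ tendsto_natCast_atTop_atTop))
    have h' := (h.const_mul (1 / 24)).const_sub (1 / 12)
    rwa [mul_zero, sub_zero] at h'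
  refine tendsto_of_tendsto_of_tendsto_of_le_of_le h tendsto_const_nhds (fun n => ?_)
    (fun n => ?_)
  · have hp : 0 < x + n := by positivity
    refine le_trans (le_of_eq ?_) (mul_le_mul_of_nonneg_left (stTheta_lower hp) hp.le)
    field_simp
    ring
  · have hp : 0 < x + n := by positivity
    refine (mul_le_mul_of_nonneg_left (stTheta_upper hp) hp.le).trans (le_of_eq ?_)
    field_simp

theorem stPhi_neg {v : ℝ} (h0 : 0 < v) (h1 : v < 1) :
    -2 * Real.log (1 - v) - v - v / (1 - v) < 0 := by
  have hd : ∀ y < (1 : ℝ), HasDerivAt (fun v : ℝ => -2 * Real.log (1 - v) - v - v / (1 - v))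
      (-(1 - 1 / (1 - y)) ^ 2) y := by
    intro y hy
    have hy' : 1 - y ≠ 0 := by linarith
    have hs : HasDerivAt (fun v : ℝ => 1 - v) (-1) y := by
      simpa using (hasDerivAt_id y).const_sub 1
    have := (((hs.log hy').const_mul (-2)).sub (hasDerivAt_id y)).sub
      ((hasDerivAt_id y).div hs hy')
    refine this.congr_deriv ?_
    simp only [id]
    field_simp
    ring
  have := strictAntiOn_of_deriv_neg (convex_Ico (0 : ℝ) 1)
    (f := fun v : ℝ => -2 * Real.log (1 - v) - v - v / (1 - v))
    (fun y hy => (hd y hy.2).continuousAt.continuousWithinAt)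
    (fun y hy => by
      rw [interior_Ico] at hy
      rw [(hd y hy.2).deriv]
      have h3 : 0 < 1 - y := by linarith [hy.2]
      have : 1 - 1 / (1 - y) ≠ 0 := by
        have : 1 - 1 / (1 - y) = -y / (1 - y) := by field_simp; ring
        rw [this]
        exact div_ne_zero (by linarith [hy.1]) h3.ne'
      have := sq_pos_of_ne_zero this
      linarith)
  simpa using this ⟨le_rfl, one_pos⟩ ⟨h0.le, h1⟩ h0

theorem stLogs {u : ℝ} (hu : 1 < u) :
    HasDerivAt (fun u => Real.log (u - 1)) (1 / (u - 1)) u ∧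
    HasDerivAt (fun u => Real.log u) (1 / u) u ∧
    HasDerivAt (fun u => Real.log (u + 1)) (1 / (u + 1)) u := by
  refine ⟨?_, ?_, ?_⟩
  · exact ((hasDerivAt_id u).sub_const 1).log (by simp only [id]; linarith)
  · exact (hasDerivAt_id u).log (by simp only [id]; linarith)
  · exact ((hasDerivAt_id u).add_const 1).log (by simp only [id]; linarith)

theorem stK_deriv {u : ℝ} (hu : 1 < u) : HasDerivAt stK (stK1 u) u := by
  obtain ⟨hm, h0, hp⟩ := stLogs hu
  have i := hasDerivAt_id u
  have h := (((((i.pow 2).const_mul 2).add_const 1).mul h0).sub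
    (((i.sub_const 1).mul (i.sub_const (1 / 2))).mul hm)).sub
    (((i.add_const 1).mul (i.add_const (1 / 2))).mul hp) |>.add_const 2
  refine h.congr_deriv ?_
  have a1 : u - 1 ≠ 0 := by linarith
  have a2 : u ≠ 0 := by linarith
  have a3 : u + 1 ≠ 0 := by linarith
  unfold stK1
  simp
  field_simp
  ring

theorem stK1_deriv {u : ℝ} (hu : 1 < u) :
    HasDerivAt stK1 (-2 * Real.log (1 - 1 / u ^ 2) - 1 / u ^ 2
      - (1 / u ^ 2) / (1 - 1 / u ^ 2)) u := by
  obtain ⟨hm, h0, hp⟩ := stLogs hu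
  have i := hasDerivAt_id u
  have a1 : u - 1 ≠ 0 := by linarith
  have a2 : u ≠ 0 := by linarith
  have a3 : u + 1 ≠ 0 := by linarith
  have a4 : u ^ 2 - 1 ≠ 0 := by nlinarith
  have h := ((((i.const_mul 4).mul h0).add ((hasDerivAt_const u (1 : ℝ)).div i a2)).sub
    (((i.const_mul 2).sub_const (3 / 2)).mul hm)).sub
    (((i.const_mul 2).add_const (3 / 2)).mul hp)
  refine h.congr_deriv ?_
  have e : 1 - 1 / u ^ 2 = (u - 1) * (u + 1) / u ^ 2 := by field_simp; ring
  rw [e, Real.log_div (mul_ne_zero a1 a3) (pow_ne_zero 2 a2), Real.log_mul a1 a3, Real.log_pow]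
  simp
  field_simp
  ring

theorem stK1_anti : StrictAntiOn stK1 (Set.Ioi 1) := by
  refine strictAntiOn_of_deriv_neg (convex_Ioi 1)
    (fun y hy => (stK1_deriv hy).continuousAt.continuousWithinAt) (fun y hy => ?_)
  rw [interior_Ioi] at hy
  have hy : 1 < y := hy
  rw [(stK1_deriv hy).deriv]
  apply stPhi_neg
  · positivity
  · rw [div_lt_one (by positivity)]
    nlinarith

theorem stK1_lower {u : ℝ} (hu : 1 < u) : -(3 / (u - 1) ^ 2) ≤ stK1 u := by
  have a1 : 0 < u - 1 := by linarith
  have a2 : 0 < u := by linarith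
  have a3 : 0 < u + 1 := by linarith
  have h1 : 2 * Real.log u - Real.log (u - 1) - Real.log (u + 1) ≥ 1 / u ^ 2 := by
    have := Real.log_le_sub_one_of_pos (show 0 < (u - 1) * (u + 1) / u ^ 2 by positivity)
    rw [Real.log_div (by positivity) (by positivity), Real.log_mul a1.ne' a3.ne',
      Real.log_pow] at this
    have e : (u - 1) * (u + 1) / u ^ 2 - 1 = -(1 / u ^ 2) := by field_simp; ring
    rw [e] at this
    push_cast at this
    linarith
  have h2 : Real.log (u + 1) - Real.log (u - 1) ≤ 2 / (u - 1) := by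
    have := Real.log_le_sub_one_of_pos (show 0 < (u + 1) / (u - 1) by positivity)
    rw [Real.log_div a3.ne' a1.ne'] at this
    have e : (u + 1) / (u - 1) - 1 = 2 / (u - 1) := by field_simp; ring
    linarith
  have h3 := mul_le_mul_of_nonneg_left h1 (show 0 ≤ 2 * u by linarith)
  have e : stK1 u = 2 * u * (2 * Real.log u - Real.log (u - 1) - Real.log (u + 1)) + 1 / u
      - 3 / 2 * (Real.log (u + 1) - Real.log (u - 1)) := by
    unfold stK1; ring
  have h4 : -(3 / (u - 1) ^ 2) ≤ 2 * u * (1 / u ^ 2) + 1 / u - 3 / 2 * (2 / (u - 1)) := by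
    have e4 : 2 * u * (1 / u ^ 2) + 1 / u - 3 / 2 * (2 / (u - 1)) = -(3 / (u * (u - 1))) := by
      field_simp
      ring
    rw [e4, neg_le_neg_iff]
    apply div_le_div_of_nonneg_left (by norm_num) (by positivity)
    nlinarith
  linarith

theorem stK1_pos {u : ℝ} (hu : 1 < u) : 0 < stK1 u := by
  have h1 : stK1 (u + 1) < stK1 u :=
    stK1_anti hu (show (1 : ℝ) < u + 1 by linarith) (by linarith)
  refine lt_of_le_of_lt ?_ h1
  have ht : Tendsto (fun w : ℝ => -(3 / (w - 1) ^ 2)) atTop (𝓝 0) := by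
    have : Tendsto (fun w : ℝ => (w - 1) ^ 2) atTop atTop :=
      (tendsto_pow_atTop (by norm_num)).comp (tendsto_atTop_add_const_right _ (-1) tendsto_id)
    simpa using (this.const_div_atTop 3).neg
  refine le_of_tendsto ht ?_
  filter_upwards [eventually_gt_atTop (u + 1)] with w hw
  exact (stK1_lower (by linarith)).trans
    (stK1_anti (show (1 : ℝ) < u + 1 by linarith) (show (1 : ℝ) < w by linarith) hw).le

theorem stK_mono : StrictMonoOn stK (Set.Ioi 1) := by
  refine strictMonoOn_of_deriv_pos (convex_Ioi 1)
    (fun y hy => (stK_deriv hy).continuousAt.continuousWithinAt) (fun y hy => ?_)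
  rw [interior_Ioi] at hy
  rw [(stK_deriv hy).deriv]
  exact stK1_pos hy

theorem stAnti_pos {a : ℕ → ℝ} (ha : StrictAnti a) (ht : Tendsto a atTop (𝓝 0)) (n : ℕ) :
    0 < a n :=
  (ha.antitone.le_of_tendsto ht (n + 1)).trans_lt (ha (Nat.lt_succ_self n))

theorem stConvex_pos {H : ℕ → ℝ} (ht : Tendsto H atTop (𝓝 0))
    (hc : ∀ n, 0 < H n - 2 * H (n + 1) + H (n + 2)) : 0 < H 0 := by
  have hd : ∀ n, 0 < H n - H (n + 1) := by
    refine stAnti_pos (a := fun n => H n - H (n + 1))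
      (strictAnti_nat_of_succ_lt fun n => ?_) ?_
    · have := hc n
      show H (n + 1) - H (n + 2) < H n - H (n + 1)
      linarith
    · simpa using ht.sub ((tendsto_add_atTop_iff_nat 1).2 ht)
  exact stAnti_pos (strictAnti_nat_of_succ_lt fun n => by linarith [hd n]) ht 0

/-- The Stirling remainder `σ` is strictly increasing on `(0, ∞)`. -/
theorem stirlingSigma_strictMono :
    ∀ x₁ x₂ : ℝ, 0 < x₁ → x₁ < x₂ → stirlingSigma x₁ < stirlingSigma x₂ := by
  intro x y hx hxy
  have hy : 0 < y := hx.trans hxy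
  rw [stirlingSigma_eq hx, stirlingSigma_eq hy]
  have := stConvex_pos
    (H := fun n : ℕ => (y + n) * stTheta (y + n) - (x + n) * stTheta (x + n))
    (by simpa using (stH_tendsto hy).sub (stH_tendsto hx)) (fun n => by
      have h1 := stTheta_second (show 0 < x + n by positivity)
      have h2 := stTheta_second (show 0 < y + n by positivity)
      have h3 : stK (x + n + 1) < stK (y + n + 1) := by
        have : (0 : ℝ) ≤ n := Nat.cast_nonneg n
        exact stK_mono (show (1 : ℝ) < x + n + 1 by linarith)
          (show (1 : ℝ) < y + n + 1 by linarith) (by linarith)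
      push_cast
      simp only [← add_assoc]
      linarith)
  simp only [Nat.cast_zero, add_zero] at this
  linarith
end

section
/- Define θ : (0,∞) → ℝ by θ(x) = 1 − σ(x), where σ(x) = 12x · ln( Γ(x+1) / (√(2πx) · (x/e)^x) ). Then θ is strictly completely monotonic on (0,∞): for every natural number n = 0, 1, 2, … and every x > 0, the n-th derivative of θ satisfies (−1)^n · θ⁽ⁿ⁾(x) > 0. -/
open Real

/-- `θ(x) = 1 − σ(x)`. -/
noncomputable def stirlingTheta (x : ℝ) : ℝ := 1 - stirlingSigma x


namespace StirlingAux
open Filter Topology MeasureTheory Set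

lemma pos_of_deriv {g g' : ℝ → ℝ} (h : ∀ t, HasDerivAt g (g' t) t) (h0 : g 0 = 0)
    (hp : ∀ t, 0 < t → 0 < g' t) : ∀ t, 0 < t → 0 < g t := by
  have hm : StrictMonoOn g (Ici 0) := by
    apply strictMonoOn_of_deriv_pos (convex_Ici 0)
    · exact fun t _ => (h t).continuousAt.continuousWithinAt
    · intro t ht
      rw [interior_Ici] at ht
      rw [(h t).deriv]
      exact hp t ht
  intro t ht
  have := hm (a := 0) (by simp) (show t ∈ Ici 0 from ht.le) ht
  rwa [h0] at this

/-- Binet's kernel. -/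
noncomputable def fS (t : ℝ) : ℝ := 1 / (t * (exp t - 1)) - 1 / t ^ 2 + 1 / (2 * t)

/-- Its derivative. -/
noncomputable def fD (t : ℝ) : ℝ :=
  -1 / (t ^ 2 * (exp t - 1)) - exp t / (t * (exp t - 1) ^ 2) + 2 / t ^ 3 - 1 / (2 * t ^ 2)

lemma em1_pos {t : ℝ} (ht : 0 < t) : 0 < exp t - 1 := by
  have := add_one_lt_exp ht.ne'
  linarith

lemma hasDerivAt_fS {t : ℝ} (ht : 0 < t) : HasDerivAt fS (fD t) t := by
  have he := (em1_pos ht).ne'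
  have ht' := ht.ne'
  have h1 : HasDerivAt (fun t : ℝ => t * (exp t - 1)) (1 * (exp t - 1) + t * exp t) t :=
    (hasDerivAt_id t).mul ((Real.hasDerivAt_exp t).sub_const 1)
  have h2 : HasDerivAt (fun t : ℝ => t ^ 2) (2 * t) t := by simpa using hasDerivAt_pow 2 t
  have h3 : HasDerivAt (fun t : ℝ => 2 * t) (2 * 1) t := (hasDerivAt_id t).const_mul 2
  have h := ((h1.fun_inv (by positivity)).sub (h2.fun_inv (by positivity))).add
    (h3.fun_inv (by positivity))
  convert! h using 1
  · ext s; simp [fS]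
  · unfold fD
    field_simp
    ring

lemma aux4 : ∀ t : ℝ, 0 < t → 0 < t * sinh t - 4 * cosh t + t ^ 2 + 4 := by
  have hid := fun t : ℝ => hasDerivAt_id' t
  apply pos_of_deriv (g' := fun t => t * cosh t - 3 * sinh t + 2 * t)
  · intro t
    have h := ((((hid t).mul (Real.hasDerivAt_sinh t)).sub
      ((Real.hasDerivAt_cosh t).const_mul 4)).add (hasDerivAt_pow 2 t)).add_const 4
    convert! h using 1
    push_cast; ring
  · simp
  apply pos_of_deriv (g' := fun t => t * sinh t - 2 * cosh t + 2)
  · intro t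
    have h := ((((hid t).mul (Real.hasDerivAt_cosh t)).sub
      ((Real.hasDerivAt_sinh t).const_mul 3)).add ((hid t).const_mul 2))
    convert! h using 1
    ring
  · simp
  apply pos_of_deriv (g' := fun t => t * cosh t - sinh t)
  · intro t
    have h := ((((hid t).mul (Real.hasDerivAt_sinh t)).sub
      ((Real.hasDerivAt_cosh t).const_mul 2)).add_const 2)
    convert! h using 1
    ring
  · simp
  apply pos_of_deriv (g' := fun t => t * sinh t)
  · intro t
    have h := ((((hid t).mul (Real.hasDerivAt_cosh t)).sub
      ((Real.hasDerivAt_sinh t))))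
    convert! h using 1
    ring
  · simp
  intro t ht
  exact mul_pos ht (sinh_pos_iff.2 ht)

lemma fD_neg {t : ℝ} (ht : 0 < t) : fD t < 0 := by
  have he := em1_pos ht
  have key : fD t = -(exp t * (2 * (t * sinh t - 4 * cosh t + t ^ 2 + 4)))
      / (2 * t ^ 3 * (exp t - 1) ^ 2) := by
    unfold fD
    have : sinh t = (exp t - (exp t)⁻¹) / 2 := by rw [sinh_eq, exp_neg]
    have h2 : cosh t = (exp t + (exp t)⁻¹) / 2 := by rw [cosh_eq, exp_neg]
    rw [this, h2]
    have := exp_pos t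
    have he' := he.ne'
    generalize exp t = E at *
    field_simp
    ring
  rw [key]
  have := aux4 t ht
  have := exp_pos t
  apply div_neg_of_neg_of_pos
  · have : 0 < exp t * (2 * (t * sinh t - 4 * cosh t + t ^ 2 + 4)) := by positivity
    linarith
  · positivity

lemma aux_low : ∀ t : ℝ, 0 < t → 0 < t * (exp t + 1) - 2 * (exp t - 1) - t ^ 3 / 6 := by
  have hid := fun t : ℝ => hasDerivAt_id' t
  have hE := fun t : ℝ => Real.hasDerivAt_exp t
  apply pos_of_deriv (g' := fun t => t * exp t - exp t + 1 - t ^ 2 / 2)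
  · intro t
    have h := (((hid t).mul ((hE t).add_const 1)).sub (((hE t).sub_const 1).const_mul 2)).sub
      ((hasDerivAt_pow 3 t).div_const 6)
    convert! h using 1
    push_cast; ring
  · simp
  apply pos_of_deriv (g' := fun t => t * (exp t - 1))
  · intro t
    have h := ((((hid t).mul (hE t)).sub (hE t)).add_const 1).sub
      ((hasDerivAt_pow 2 t).div_const 2)
    convert! h using 1
    push_cast; ring
  · simp
  intro t ht
  exact mul_pos ht (em1_pos ht)

lemma aux_up : ∀ t : ℝ, 0 < t →
    0 < t ^ 2 * (exp t - 1) - 6 * (t * (exp t + 1)) + 12 * (exp t - 1) := by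
  have hid := fun t : ℝ => hasDerivAt_id' t
  have hE := fun t : ℝ => Real.hasDerivAt_exp t
  apply pos_of_deriv (g' := fun t => exp t * (t ^ 2 - 4 * t + 6) - 2 * t - 6)
  · intro t
    have h := (((hasDerivAt_pow 2 t).mul ((hE t).sub_const 1)).sub
      (((hid t).mul ((hE t).add_const 1)).const_mul 6)).add (((hE t).sub_const 1).const_mul 12)
    convert! h using 1
    push_cast; ring
  · simp
  apply pos_of_deriv (g' := fun t => exp t * (t ^ 2 - 2 * t + 2) - 2)
  · intro t
    have h := (((hE t).mul (((hasDerivAt_pow 2 t).sub ((hid t).const_mul 4)).add_const 6)).sub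
      ((hid t).const_mul 2)).sub_const 6
    convert! h using 1
    simp only [Pi.sub_apply]
    push_cast; ring
  · simp
  apply pos_of_deriv (g' := fun t => exp t * t ^ 2)
  · intro t
    have h := (((hE t).mul (((hasDerivAt_pow 2 t).sub ((hid t).const_mul 2)).add_const 2))).sub_const 2
    convert! h using 1
    simp only [Pi.sub_apply]
    push_cast; ring
  · simp
  intro t ht
  positivity

lemma fS_eq {t : ℝ} (ht : 0 < t) :
    fS t = (t * (exp t + 1) - 2 * (exp t - 1)) / (2 * t ^ 2 * (exp t - 1)) := by
  have he := (em1_pos ht).ne'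
  unfold fS
  field_simp
  ring

lemma fS_le {t : ℝ} (ht : 0 < t) : fS t ≤ 1 / 12 := by
  have he := em1_pos ht
  rw [fS_eq ht, div_le_iff₀ (by positivity)]
  linarith [aux_up t ht]

lemma le_fS {t : ℝ} (ht : 0 < t) : 1 / 12 * (t / (exp t - 1)) ≤ fS t := by
  have he := em1_pos ht
  have h : 1 / 12 * (t / (exp t - 1)) = (t ^ 3 / 6) / (2 * t ^ 2 * (exp t - 1)) := by
    field_simp
    ring
  rw [h, fS_eq ht]
  gcongr
  linarith [aux_low t ht]

lemma fS_nonneg {t : ℝ} (ht : 0 < t) : 0 ≤ fS t := by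
  have he := em1_pos ht
  exact le_trans (by positivity) (le_fS ht)

lemma tendsto_expm1_div : Tendsto (fun t : ℝ => (exp t - 1) / t) (𝓝[>] 0) (𝓝 1) := by
  have h := (Real.hasDerivAt_exp 0).tendsto_slope_zero_right
  simp only [zero_add, exp_zero, smul_eq_mul] at h
  exact h.congr fun t => by rw [div_eq_inv_mul]

lemma tendsto_fS_zero : Tendsto fS (𝓝[>] 0) (𝓝 (1 / 12)) := by
  have h : Tendsto (fun t : ℝ => 1 / 12 * (t / (exp t - 1))) (𝓝[>] 0) (𝓝 (1 / 12)) := by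
    have := (tendsto_expm1_div.inv₀ one_ne_zero).const_mul (1 / 12)
    simp only [inv_one, mul_one, inv_div] at this
    exact this
  apply tendsto_of_tendsto_of_tendsto_of_le_of_le' h tendsto_const_nhds
  · filter_upwards [self_mem_nhdsWithin] with t ht using le_fS ht
  · filter_upwards [self_mem_nhdsWithin] with t ht using fS_le ht

lemma tendsto_fS_atTop : Tendsto fS atTop (𝓝 0) := by
  have h1 : Tendsto (fun t : ℝ => 1 / t + 1 / (2 * t)) atTop (𝓝 0) := by
    have h := (tendsto_inv_atTop_zero (𝕜 := ℝ))
    have := h.add (h.const_mul (1 / 2))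
    simp only [mul_zero, add_zero] at this
    refine this.congr fun t => ?_
    field_simp
  apply tendsto_of_tendsto_of_tendsto_of_le_of_le' tendsto_const_nhds h1
  · filter_upwards [eventually_gt_atTop 0] with t ht using fS_nonneg ht
  · filter_upwards [eventually_gt_atTop 1] with t ht
    have ht0 : 0 < t := by linarith
    unfold fS
    have h2 : 1 / (t * (exp t - 1)) ≤ 1 / t := by
      apply one_div_le_one_div_of_le ht0
      nlinarith [add_one_le_exp t]
    have : 0 ≤ 1 / t ^ 2 := by positivity
    linarith

/-- FTC on `(0,∞)` with limits at both ends. -/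
lemma ftc0 {F F' : ℝ → ℝ} {a b : ℝ} (hd : ∀ t, 0 < t → HasDerivAt F (F' t) t)
    (hint : IntegrableOn F' (Ioi 0)) (h0 : Tendsto F (𝓝[>] 0) (𝓝 a))
    (hi : Tendsto F atTop (𝓝 b)) : ∫ t in Ioi 0, F' t = b - a := by
  have := integral_Ioi_of_hasDerivAt_of_tendsto (f := Function.update F 0 a) (f' := F') (a := 0)
    (m := b) ?_ ?_ hint ?_
  · simpa using this
  · rw [continuousWithinAt_update_same]
    simpa using h0
  · intro t ht
    refine (hd t ht).congr_of_eventuallyEq ?_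
    filter_upwards [eventually_ne_nhds (ne_of_gt ht)] with s hs
    simp [hs]
  · refine hi.congr' ?_
    filter_upwards [eventually_ne_atTop 0] with s hs
    simp [hs]

lemma integrable_fD : IntegrableOn fD (Ioi 0) := by
  apply integrableOn_Ioi_deriv_of_nonpos (g := Function.update fS 0 (1 / 12)) (l := 0)
  · rw [continuousWithinAt_update_same]
    simpa using tendsto_fS_zero
  · intro t ht
    refine (hasDerivAt_fS ht).congr_of_eventuallyEq ?_
    filter_upwards [eventually_ne_nhds (ne_of_gt ht)] with s hs
    simp [hs]
  · exact fun t ht => (fD_neg ht).le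
  · refine tendsto_fS_atTop.congr' ?_
    filter_upwards [eventually_ne_atTop 0] with s hs
    simp [hs]

lemma measurable_fS : Measurable fS := by unfold fS; fun_prop

lemma measurable_fD : Measurable fD := by unfold fD; fun_prop

lemma integrable_exp {x : ℝ} (hx : 0 < x) :
    IntegrableOn (fun t : ℝ => exp (-(x * t))) (Ioi 0) := by
  simpa using integrableOn_exp_mul_Ioi (a := -x) (by linarith) 0

lemma integrable_fS {x : ℝ} (hx : 0 < x) :
    IntegrableOn (fun t => fS t * exp (-(x * t))) (Ioi 0) := by
  refine Integrable.bdd_mul (c := 1 / 12) (integrable_exp hx) measurable_fS.aestronglyMeasurable ?_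
  filter_upwards [ae_restrict_mem measurableSet_Ioi] with t ht
  rw [norm_eq_abs, abs_of_nonneg (fS_nonneg ht)]
  exact fS_le ht

lemma integrable_fD_exp {x : ℝ} (hx : 0 ≤ x) :
    IntegrableOn (fun t => fD t * exp (-(x * t))) (Ioi 0) := by
  refine Integrable.mul_bdd (c := 1) integrable_fD (by fun_prop) ?_
  filter_upwards [ae_restrict_mem measurableSet_Ioi] with t ht
  rw [norm_eq_abs, abs_of_pos (exp_pos _)]
  apply exp_le_one_iff.2
  have : 0 ≤ x * t := mul_nonneg hx (le_of_lt ht)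
  linarith

/-- Laplace transform of Binet's kernel. -/
noncomputable def L (x : ℝ) : ℝ := ∫ t in Ioi 0, fS t * exp (-(x * t))

lemma L_nonneg (x : ℝ) : 0 ≤ L x :=
  setIntegral_nonneg measurableSet_Ioi fun _ ht => mul_nonneg (fS_nonneg ht) (exp_pos _).le

lemma tendsto_exp_neg {x : ℝ} (hx : 0 < x) :
    Tendsto (fun t : ℝ => exp (-(x * t))) atTop (𝓝 0) :=
  tendsto_exp_neg_atTop_nhds_zero.comp (tendsto_id.const_mul_atTop hx)

lemma tendsto_exp_zero (x : ℝ) :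
    Tendsto (fun t : ℝ => exp (-(x * t))) (𝓝[>] 0) (𝓝 1) := by
  have : Continuous (fun t : ℝ => exp (-(x * t))) := by fun_prop
  have := this.tendsto 0
  simp only [mul_zero, neg_zero, exp_zero] at this
  exact this.mono_left nhdsWithin_le_nhds

lemma hasDerivAt_exp' (x t : ℝ) :
    HasDerivAt (fun t : ℝ => exp (-(x * t))) (-x * exp (-(x * t))) t := by
  have := (((hasDerivAt_id' t).const_mul x).fun_neg).exp
  convert! this using 1
  ring

lemma x_mul_L {x : ℝ} (hx : 0 < x) :
    x * L x = 1 / 12 + ∫ t in Ioi 0, fD t * exp (-(x * t)) := by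
  have h := ftc0 (F := fun t => fS t * exp (-(x * t)))
    (F' := fun t => fD t * exp (-(x * t)) - x * (fS t * exp (-(x * t)))) (a := 1 / 12) (b := 0)
    ?_ ?_ ?_ ?_
  · rw [integral_sub (integrable_fD_exp hx.le) ((integrable_fS hx).const_mul x),
      integral_const_mul] at h
    unfold L
    linarith
  · intro t ht
    have := (hasDerivAt_fS ht).mul (hasDerivAt_exp' x t)
    convert! this using 1
    ring
  · exact (integrable_fD_exp hx.le).sub ((integrable_fS hx).const_mul x)
  · simpa using tendsto_fS_zero.mul (tendsto_exp_zero x)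
  · simpa using tendsto_fS_atTop.mul (tendsto_exp_neg hx)

lemma L_le {x : ℝ} (hx : 0 < x) : x * L x ≤ 1 / 12 := by
  rw [x_mul_L hx]
  have : ∫ t in Ioi 0, fD t * exp (-(x * t)) ≤ 0 :=
    setIntegral_nonpos measurableSet_Ioi fun t ht =>
      mul_nonpos_of_nonpos_of_nonneg (fD_neg ht).le (exp_pos _).le
  linarith

/-- Difference quotient appearing in the functional equation. -/
noncomputable def G (x t : ℝ) : ℝ := (exp (-(x * t)) - exp (-((x + 1) * t))) / t

lemma exp_split (x t : ℝ) : exp (-((x + 1) * t)) = exp (-(x * t)) * (exp t)⁻¹ := by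
  rw [← exp_neg, ← exp_add]
  congr 1
  ring

lemma G_nonneg {x t : ℝ} (ht : 0 < t) : 0 ≤ G x t := by
  unfold G
  apply div_nonneg _ ht.le
  rw [sub_nonneg]
  apply exp_le_exp.2
  nlinarith

lemma G_le {x t : ℝ} (ht : 0 < t) : G x t ≤ exp (-(x * t)) := by
  unfold G
  rw [div_le_iff₀ ht]
  have h : exp (-((x + 1) * t)) = exp (-(x * t)) * exp (-t) := by
    rw [← exp_add]; congr 1; ring
  rw [h]
  have h1 := add_one_le_exp (-t)
  nlinarith [exp_pos (-(x * t))]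

lemma integrable_G {x : ℝ} (hx : 0 < x) : IntegrableOn (G x) (Ioi 0) := by
  refine Integrable.mono' (integrable_exp hx) ?_ ?_
  · have : Measurable (G x) := by unfold G; fun_prop
    exact this.aestronglyMeasurable
  · filter_upwards [ae_restrict_mem measurableSet_Ioi] with t ht
    rw [norm_eq_abs, abs_of_nonneg (G_nonneg ht)]
    exact G_le ht

lemma integral_G {x : ℝ} (hx : 0 < x) : ∫ t in Ioi 0, G x t = log ((x + 1) / x) := by
  have hc : Continuous fun t : ℝ => exp (-t) := by fun_prop
  have hG : (fun t : ℝ => t⁻¹ • (exp (-(x * t)) - exp (-((x + 1) * t)))) = G x := by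
    ext t
    simp [G, div_eq_inv_mul]
  have h := Frullani.integral_Ioi_eq (f := fun t : ℝ => exp (-t)) (a := x) (b := x + 1) (L := 1)
    (R := 0) (hc.locallyIntegrable.locallyIntegrableOn _) hx (by linarith)
    (by simpa using tendsto_exp_zero 1) tendsto_exp_neg_atTop_nhds_zero
    (by rw [hG]; exact integrable_G hx)
  rw [hG] at h
  simpa using h

lemma L_sub {x : ℝ} (hx : 0 < x) :
    L x - L (x + 1) = (x + 1 / 2) * log ((x + 1) / x) - 1 := by
  have hx1 : 0 < x + 1 := by linarith
  have hI : IntegrableOn (fun t => (fS t * exp (-(x * t)) - fS t * exp (-((x + 1) * t)))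
      - (x + 1 / 2) * G x t) (Ioi 0) :=
    ((integrable_fS hx).sub (integrable_fS hx1)).sub ((integrable_G hx).const_mul _)
  have h := ftc0 (F := G x) (F' := fun t => (fS t * exp (-(x * t)) - fS t * exp (-((x + 1) * t)))
      - (x + 1 / 2) * G x t) (a := 1) (b := 0) ?_ hI ?_ ?_
  · have hA : Integrable (fun t => fS t * exp (-(x * t)) - fS t * exp (-((x + 1) * t)))
      (volume.restrict (Ioi 0)) := (integrable_fS hx).sub (integrable_fS hx1)
    rw [integral_sub hA ((integrable_G hx).const_mul _), integral_sub (integrable_fS hx) (integrable_fS hx1),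
      integral_const_mul, integral_G hx] at h
    unfold L
    linarith
  · intro t ht
    have h := ((hasDerivAt_exp' x t).sub (hasDerivAt_exp' (x + 1) t)).div (hasDerivAt_id' t) ht.ne'
    convert! h using 1
    simp only [Pi.sub_apply]
    have he := (em1_pos ht).ne'
    have hE := exp_pos t
    unfold G fS
    rw [exp_split]
    generalize exp (-(x * t)) = A
    generalize exp t = E at *
    field_simp
    ring
  · have h1 := (tendsto_expm1_div.mul (tendsto_exp_zero (x + 1)))
    simp only [mul_one] at h1
    refine h1.congr fun t => ?_
    unfold G
    rw [exp_split]
    have := exp_pos t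
    field_simp
  · apply tendsto_of_tendsto_of_tendsto_of_le_of_le' tendsto_const_nhds (tendsto_exp_neg hx)
    · filter_upwards [eventually_gt_atTop 0] with t ht using G_nonneg ht
    · filter_upwards [eventually_gt_atTop 0] with t ht using G_le ht


/-- Logarithm of Stirling's remainder. -/
noncomputable def M (x : ℝ) : ℝ :=
  log (Gamma (x + 1)) - 1 / 2 * log (2 * π * x) - x * log x + x

lemma log_Gamma_add_one {y : ℝ} (hy : 0 < y) :
    log (Gamma (y + 1)) = log (Gamma y) + log y := by
  rw [Gamma_add_one hy.ne', log_mul hy.ne' (Gamma_pos_of_pos hy).ne']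
  ring

lemma M_sub {x : ℝ} (hx : 0 < x) :
    M x - M (x + 1) = (x + 1 / 2) * log ((x + 1) / x) - 1 := by
  have hx1 : 0 < x + 1 := by linarith
  unfold M
  rw [log_Gamma_add_one hx1, log_mul (by positivity) hx.ne', log_mul (by positivity) hx1.ne',
    log_div hx1.ne' hx.ne']
  ring

lemma tendsto_log_one_add (x : ℝ) :
    Tendsto (fun n : ℕ => log (1 + x / n)) atTop (𝓝 0) := by
  have h : Tendsto (fun n : ℕ => 1 + x / (n : ℝ)) atTop (𝓝 (1 + 0)) :=
    (tendsto_const_div_atTop_nhds_zero_nat x).const_add 1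
  rw [add_zero] at h
  have := h.log one_ne_zero
  rwa [log_one] at this

lemma tendsto_M {x : ℝ} (hx : 0 < x) : Tendsto (fun n : ℕ => M (x + n)) atTop (𝓝 0) := by
  have h1 := (BohrMollerup.tendsto_log_gamma hx).const_sub (log (Gamma x))
  have h2 := (Stirling.tendsto_stirlingSeq_sqrt_pi.log (by positivity)).sub_const (log (√π))
  have h3 := (tendsto_mul_log_one_add_div_atTop x).comp (tendsto_natCast_atTop_atTop (R := ℝ))
  have h4 := tendsto_log_one_add x
  have h := (h1.add h2).add (((h4.const_mul (-(1 / 2) - x)).sub h3).add_const x)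
  have hz : log (Gamma x) - log (Gamma x) + (log (√π) - log (√π)) +
      ((-(1 / 2) - x) * 0 - x + x) = 0 := by ring
  rw [hz] at h
  refine h.congr' ?_
  filter_upwards [eventually_gt_atTop 0] with n hn
  have hn' : (0 : ℝ) < n := by exact_mod_cast hn
  have hxn : 0 < x + n := by positivity
  have hG := BohrMollerup.f_add_nat_eq (f := fun y => log (Gamma y)) (x := x)
    (fun hy => log_Gamma_add_one hy) hx (n + 1)
  have h5 : log (1 + x / n) = log (x + n) - log n := by
    rw [← log_div hxn.ne' hn'.ne']
    congr 1
    field_simp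
    ring
  rw [Stirling.log_stirlingSeq_formula, BohrMollerup.logGammaSeq, Function.comp_apply, h5, M,
    log_div hn'.ne' (exp_pos 1).ne', log_exp, log_sqrt pi_pos.le, log_mul two_ne_zero hn'.ne',
    log_mul (by positivity) hxn.ne', log_mul two_ne_zero pi_pos.ne']
  have h6 : x + (n : ℝ) + 1 = x + ((n + 1 : ℕ) : ℝ) := by push_cast; ring
  rw [h6, hG]
  ring

lemma tendsto_L {x : ℝ} (hx : 0 < x) : Tendsto (fun n : ℕ => L (x + n)) atTop (𝓝 0) := by
  have h := tendsto_const_div_atTop_nhds_zero_nat (1 / 12 : ℝ)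
  apply tendsto_of_tendsto_of_tendsto_of_le_of_le' tendsto_const_nhds h
  · exact Eventually.of_forall fun n => L_nonneg _
  · filter_upwards [eventually_gt_atTop 0] with n hn
    have hn' : (0 : ℝ) < n := by exact_mod_cast hn
    have h1 := L_le (x := x + n) (by positivity)
    have h2 := L_nonneg (x + n)
    rw [le_div_iff₀ hn']
    nlinarith [mul_nonneg hx.le h2]

lemma M_eq_L {x : ℝ} (hx : 0 < x) : M x = L x := by
  have hc : ∀ n : ℕ, M (x + n) - L (x + n) = M x - L x := by
    intro n
    induction n with
    | zero => simp
    | succ n ih =>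
      have hxn : 0 < x + n := by positivity
      have h1 := M_sub hxn
      have h2 := L_sub hxn
      have h3 : x + ((n + 1 : ℕ) : ℝ) = x + n + 1 := by push_cast; ring
      rw [h3]
      linarith
  have h := (tendsto_M hx).sub (tendsto_L hx)
  simp only [hc, sub_zero] at h
  have := tendsto_nhds_unique tendsto_const_nhds h
  linarith

lemma theta_eq {x : ℝ} (hx : 0 < x) :
    stirlingTheta x = ∫ t in Ioi 0, -12 * fD t * exp (-(x * t)) := by
  have h : log (Gamma (x + 1) / (√(2 * π * x) * (x / exp 1) ^ x)) = M x := by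
    have hd : 0 < x / exp 1 := by positivity
    rw [log_div (Gamma_pos_of_pos (by linarith)).ne' (by positivity),
      log_mul (by positivity) (by positivity), log_rpow hd, log_sqrt (by positivity),
      log_div hx.ne' (exp_pos 1).ne', log_exp, M]
    ring
  rw [stirlingTheta, stirlingSigma, h, M_eq_L hx]
  have h2 := x_mul_L hx
  simp_rw [mul_assoc]
  rw [integral_const_mul, h2]
  ring

/-- The measure on `(0,∞)` whose Laplace transform is `θ`. -/
noncomputable def ν : Measure ℝ :=
  (volume.restrict (Ioi 0)).withDensity fun t => ENNReal.ofReal (-12 * fD t)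

lemma integral_ν (g : ℝ → ℝ) : ∫ t, g t ∂ν = ∫ t in Ioi 0, -12 * fD t * g t := by
  unfold ν
  rw [integral_withDensity_eq_integral_toReal_smul
    (measurable_fD.const_mul (-12)).ennreal_ofReal (by simp)]
  refine setIntegral_congr_fun measurableSet_Ioi fun t ht => ?_
  have := fD_neg ht
  simp only [smul_eq_mul]
  rw [ENNReal.toReal_ofReal (by linarith)]

instance : IsFiniteMeasure ν :=
  isFiniteMeasure_withDensity_ofReal (Integrable.const_mul integrable_fD (-12)).hasFiniteIntegral

lemma theta_eq_mgf {x : ℝ} (hx : 0 < x) :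
    stirlingTheta x = ProbabilityTheory.mgf (fun t => -t) ν x := by
  rw [theta_eq hx, ProbabilityTheory.mgf, integral_ν]
  simp

lemma mem_interior {x : ℝ} (hx : 0 < x) :
    x ∈ interior (ProbabilityTheory.integrableExpSet (fun t : ℝ => -t) ν) := by
  refine interior_maximal (s := ProbabilityTheory.integrableExpSet (fun t : ℝ => -t) ν)
    (t := Ioi 0) ?_ isOpen_Ioi hx
  intro y hy
  change Integrable _ ν
  unfold ν
  rw [integrable_withDensity_iff (measurable_fD.const_mul (-12)).ennreal_ofReal (by simp)]
  refine ((integrable_fD_exp (le_of_lt hy)).const_mul (-12)).congr ?_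
  filter_upwards [ae_restrict_mem measurableSet_Ioi] with t ht
  have := fD_neg ht
  rw [ENNReal.toReal_ofReal (by linarith), mul_neg]
  ring

end StirlingAux

/-- `θ` is strictly completely monotonic on `(0, ∞)`:
`(−1)^n · θ⁽ⁿ⁾(x) > 0` for all `n ≥ 0` and `x > 0`. -/
theorem stirlingTheta_strictly_completely_monotonic :
    ∀ (n : ℕ) (x : ℝ), 0 < x → 0 < (-1 : ℝ) ^ n * iteratedDeriv n stirlingTheta x := by
  intro n x hx
  have he : stirlingTheta =ᶠ[nhds x]
      ProbabilityTheory.mgf (fun t => -t) StirlingAux.ν := by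
    filter_upwards [lt_mem_nhds hx] with y hy using StirlingAux.theta_eq_mgf hy
  have hm := StirlingAux.mem_interior hx
  rw [he.iteratedDeriv_eq n, ProbabilityTheory.iteratedDeriv_mgf hm n,
    ← MeasureTheory.integral_const_mul, StirlingAux.integral_ν]
  have hi := (ProbabilityTheory.integrable_pow_mul_exp_of_mem_interior_integrableExpSet hm n).const_mul
    ((-1 : ℝ) ^ n)
  unfold StirlingAux.ν at hi
  rw [MeasureTheory.integrable_withDensity_iff
    (StirlingAux.measurable_fD.const_mul (-12)).ennreal_ofReal (by simp)] at hi
  have hpos : ∀ t ∈ Set.Ioi (0 : ℝ),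
      0 < -12 * StirlingAux.fD t * ((-1) ^ n * ((-t) ^ n * exp (x * -t))) := by
    intro t ht
    have h1 := StirlingAux.fD_neg ht
    have h2 : (-1 : ℝ) ^ n * ((-t) ^ n * exp (x * -t)) = t ^ n * exp (x * -t) := by
      rw [← mul_assoc, ← mul_pow]
      simp
    rw [h2]
    have h3 : 0 < t ^ n := pow_pos ht n
    have h4 : 0 < -12 * StirlingAux.fD t := by linarith
    positivity
  rw [MeasureTheory.setIntegral_pos_iff_support_of_nonneg_ae]
  · have hs : Set.Ioi (0 : ℝ) ⊆ Function.support
        (fun t => -12 * StirlingAux.fD t * ((-1) ^ n * ((-t) ^ n * exp (x * -t)))) ∩ Set.Ioi 0 :=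
      fun t ht => ⟨(hpos t ht).ne', ht⟩
    refine lt_of_lt_of_le ?_ (MeasureTheory.measure_mono hs)
    simp
  · filter_upwards [MeasureTheory.ae_restrict_mem measurableSet_Ioi] with t ht using (hpos t ht).le
  · refine hi.congr ?_
    filter_upwards [MeasureTheory.ae_restrict_mem measurableSet_Ioi] with t ht
    have := StirlingAux.fD_neg ht
    rw [ENNReal.toReal_ofReal (by linarith)]
    ring
end
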